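/- arXiv:1911.06565 — 2 statements merged into one kernel-verified Lean document; each statement's English description precedes it below -/
import Mathlib

section
/- Let β, a, b, c > 0 and t₀ < t₁ be real numbers. Let φ : [t₀, t₁] → ℝ be continuous on [t₀, t₁] and differentiable on (t₀, t₁), with φ(t₀) = 0, φ(t₁) = c, φ(t) < c for all t ∈ [t₀, t₁), and suppose that φ'(t) ≤ β·φ(t)² + a·φ(t) + b for every t ∈ (t₀, t₁) with 0 ≤ φ(t) ≤ c. Then t₁ − t₀ ≥ c/(β·c² + a·c + b) > 0. -/
/-- **Strictly positive lower bound on the inter-event time.**  If `φ` is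
continuous on `[t₀, t₁]`, differentiable on `(t₀, t₁)` with `φ(t₀) = 0`,
`φ(t₁) = c`, `φ < c` before `t₁`, and satisfies the quadratic differential
inequality `φ' ≤ β φ² + a φ + b` wherever `0 ≤ φ ≤ c`, then
`t₁ − t₀ ≥ c/(β c² + a c + b) > 0`. -/
theorem inter_event_time_lower_bound
    (β a b c t₀ t₁ : ℝ) (hβ : 0 < β) (ha : 0 < a) (hb : 0 < b) (hc : 0 < c)
    (ht : t₀ < t₁)
    (φ φ' : ℝ → ℝ)
    (hcont : ContinuousOn φ (Set.Icc t₀ t₁))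
    (hderiv : ∀ t ∈ Set.Ioo t₀ t₁, HasDerivAt φ (φ' t) t)
    (h0 : φ t₀ = 0) (h1 : φ t₁ = c)
    (hlt : ∀ t ∈ Set.Ico t₀ t₁, φ t < c)
    (hineq : ∀ t ∈ Set.Ioo t₀ t₁, 0 ≤ φ t → φ t ≤ c →
      φ' t ≤ β * φ t ^ 2 + a * φ t + b) :
    c / (β * c ^ 2 + a * c + b) ≤ t₁ - t₀ ∧
    0 < c / (β * c ^ 2 + a * c + b) := by
  have hK : 0 < β * c ^ 2 + a * c + b := by positivity
  refine ⟨?_, div_pos hc hK⟩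
  have hcompact : IsCompact (Set.Icc t₀ t₁ ∩ φ ⁻¹' Set.Iic 0) :=
    isCompact_Icc.of_isClosed_subset
      (hcont.preimage_isClosed_of_isClosed isClosed_Icc isClosed_Iic) Set.inter_subset_left
  obtain ⟨s, ⟨hs, hφs⟩, hmax⟩ :=
    hcompact.exists_isGreatest ⟨t₀, Set.left_mem_Icc.2 ht.le, h0.le⟩
  have hφs : φ s ≤ 0 := hφs
  have hs₁ : s < t₁ := hs.2.lt_of_ne (by rintro rfl; linarith)
  obtain ⟨ξ, hξ, hslope⟩ := exists_hasDerivAt_eq_slope φ φ' hs₁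
    (hcont.mono (Set.Icc_subset_Icc_left hs.1))
    (fun t h => hderiv t ⟨hs.1.trans_lt h.1, h.2⟩)
  have hξ₀ : t₀ < ξ := hs.1.trans_lt hξ.1
  have hpos : 0 ≤ φ ξ := by
    by_contra! h
    exact (hmax ⟨⟨hξ₀.le, hξ.2.le⟩, h.le⟩).not_gt hξ.1
  have hle : φ ξ ≤ c := (hlt ξ ⟨hξ₀.le, hξ.2⟩).le
  have hbound : φ' ξ ≤ β * c ^ 2 + a * c + b :=
    (hineq ξ ⟨hξ₀, hξ.2⟩ hpos hle).trans (by gcongr)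
  rw [hslope, div_le_iff₀ (sub_pos.2 hs₁), h1] at hbound
  rw [div_le_iff₀ hK]
  nlinarith [mul_le_mul_of_nonneg_left hs.1 hK.le]
end

section
/- Let N, n ≥ 1, let σ_on > 0 and m₀ > 0. Let K_f ∈ ℝ^{N×N} be symmetric positive semidefinite, U ∈ ℝ^{N×N} a diagonal matrix, v ∈ ℝᴺ, and let m_g : ℝⁿ → ℝ satisfy m_g(x) ≥ m₀ for all x ∈ ℝⁿ. Let Ḡ : ℝⁿ → (symmetric PSD N×N matrices) be fixed, i.e., Ḡ ∈ ℝ^{N×N} symmetric positive semidefinite, and let k̄ : ℝⁿ → ℝᴺ satisfy |k̄(x)_i| ≤ 1 for all x ∈ ℝⁿ and all i. Then there exists σ_g* > 0 such that for every σ_g with 0 < σ_g ≤ σ_g*, the matrix K_f + σ_g²·U Ḡ Uᵀ + σ_on²·I is positive definite, and for all x ∈ ℝⁿ: m_g(x) + σ_g²·k̄(x)ᵀ U (K_f + σ_g²·U Ḡ Uᵀ + σ_on²·I)⁻¹ v > 0. -/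
/-- The inverse of a continuous family of square matrices over a topological field is continuous
at every parameter where the determinant does not vanish. -/
theorem ContinuousAt.matrix_inv_of_det_ne_zero {X m 𝕜 : Type*} [TopologicalSpace X] [Fintype m]
    [DecidableEq m] [Field 𝕜] [TopologicalSpace 𝕜] [IsTopologicalDivisionRing 𝕜]
    {A : X → Matrix m m 𝕜} {x : X} (hA : Continuous A) (hx : (A x).det ≠ 0) :
    ContinuousAt (fun y => (A y)⁻¹) x := by
  simp only [Matrix.inv_def, Ring.inverse_eq_inv]
  exact (hA.matrix_det.continuousAt.inv₀ hx).smul hA.matrix_adjugate.continuousAt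

open Matrix in
theorem abs_dotProduct_le_sum_abs {m : Type*} [Fintype m] {a b : m → ℝ} (ha : ∀ i, |a i| ≤ 1) :
    |a ⬝ᵥ b| ≤ ∑ i, |b i| := by
  refine (Finset.abs_sum_le_sum_abs _ _).trans (Finset.sum_le_sum fun i _ => ?_)
  rw [abs_mul]
  exact mul_le_of_le_one_left (abs_nonneg _) (ha i)

open Matrix in
/-- **For sufficiently small signal variance the strictly positive prior mean
dominates the data-dependent correction, so the estimate `ĝ` is strictly
positive everywhere.** -/
theorem exists_small_signal_variance_ghat_positive
    {N n : ℕ} (hN : 1 ≤ N) (hn : 1 ≤ n)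
    (σon m₀ : ℝ) (hσon : 0 < σon) (hm₀ : 0 < m₀)
    (Kf : Matrix (Fin N) (Fin N) ℝ) (hKf : Kf.PosSemidef)
    (U : Matrix (Fin N) (Fin N) ℝ) (hU : U.IsDiag)
    (v : Fin N → ℝ)
    (mg : EuclideanSpace ℝ (Fin n) → ℝ) (hmg : ∀ x, m₀ ≤ mg x)
    (G : Matrix (Fin N) (Fin N) ℝ) (hG : G.PosSemidef)
    (kb : EuclideanSpace ℝ (Fin n) → Fin N → ℝ) (hkb : ∀ x i, |kb x i| ≤ 1) :
    ∃ σgstar : ℝ, 0 < σgstar ∧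
      ∀ σg : ℝ, 0 < σg → σg ≤ σgstar →
        (Kf + σg ^ 2 • (U * G * Uᵀ) +
          σon ^ 2 • (1 : Matrix (Fin N) (Fin N) ℝ)).PosDef ∧
        ∀ x : EuclideanSpace ℝ (Fin n),
          0 < mg x + σg ^ 2 *
            (kb x ⬝ᵥ (U *ᵥ ((Kf + σg ^ 2 • (U * G * Uᵀ) +
              σon ^ 2 • (1 : Matrix (Fin N) (Fin N) ℝ))⁻¹ *ᵥ v))) := by
  set A : ℝ → Matrix (Fin N) (Fin N) ℝ := fun s =>
    Kf + s ^ 2 • (U * G * Uᵀ) + σon ^ 2 • (1 : Matrix (Fin N) (Fin N) ℝ)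
  have hpd : ∀ s, (A s).PosDef := fun s => by
    have hUGU : (U * G * Uᵀ).PosSemidef := by
      simpa using hG.mul_mul_conjTranspose_same U
    exact Matrix.PosDef.posSemidef_add (hKf.add (hUGU.smul (sq_nonneg s)))
      (Matrix.PosDef.one.smul (pow_pos hσon 2))
  have hAc : Continuous A := by fun_prop
  have hinv : ContinuousAt (fun s => (A s)⁻¹) 0 :=
    .matrix_inv_of_det_ne_zero hAc (hpd 0).det_pos.ne'
  have hF : ContinuousAt (fun s : ℝ => s ^ 2 * ∑ i, |(U *ᵥ ((A s)⁻¹ *ᵥ v)) i|) 0 := by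
    have hw : ContinuousAt (fun s => U *ᵥ ((A s)⁻¹ *ᵥ v)) 0 :=
      ContinuousAt.comp (f := fun s => (A s)⁻¹)
        (g := fun B : Matrix (Fin N) (Fin N) ℝ => U *ᵥ (B *ᵥ v))
        (Continuous.continuousAt (by fun_prop)) hinv
    fun_prop
  have hsmall := hF.eventually_lt_const (u := m₀) (by simpa using hm₀)
  obtain ⟨ε, hε, hball⟩ := Metric.eventually_nhds_iff.mp hsmall
  refine ⟨ε / 2, half_pos hε, fun s hs hsε => ⟨hpd s, fun x => ?_⟩⟩
  have hlt := hball (y := s) (by rw [Real.dist_eq, sub_zero, abs_of_pos hs]; linarith)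
  have hdot := neg_le_of_abs_le
    (abs_dotProduct_le_sum_abs (b := U *ᵥ ((A s)⁻¹ *ᵥ v)) (hkb x))
  have := mul_le_mul_of_nonneg_left hdot (sq_nonneg s)
  linarith [hmg x]
end
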